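/- Let K, L be convex bodies in ℝⁿ and let ρ > 0. Then d_bL(μ_{K,ρ}, μ_{L,ρ}) ≤ ∫_{K^ρ ∩ L^ρ} ‖p_K(x) − p_L(x)‖ dx + ∫_{K^ρ ∩ L^ρ} ‖u_K(x) − u_L(x)‖ dx + vol_n(K^ρ △ L^ρ), where △ denotes the symmetric difference of sets and vol_n is n-dimensional Lebesgue measure. -/

import Mathlib

open MeasureTheory Metric Set Real Pointwise RealInnerProductSpace

noncomputable section

/-- Euclidean n-space. -/
abbrev En (n : ℕ) : Type := EuclideanSpace ℝ (Fin n)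

/-- A convex body: a nonempty compact convex set. -/
def IsConvexBody {n : ℕ} (K : Set (En n)) : Prop :=
  K.Nonempty ∧ IsCompact K ∧ Convex ℝ K

/-- The parallel body `K_ρ = K + ρ Bⁿ`. -/
def pbody {n : ℕ} (K : Set (En n)) (ρ : ℝ) : Set (En n) :=
  K + Metric.closedBall (0 : En n) ρ

/-- `K^ρ = K_ρ \ K`. -/
def shell {n : ℕ} (K : Set (En n)) (ρ : ℝ) : Set (En n) :=
  pbody K ρ \ K

/-- `p` is the metric projection onto `K`. -/
def IsMetricProj {n : ℕ} (K : Set (En n)) (p : En n → En n) : Prop :=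
  ∀ x, p x ∈ K ∧ dist x (p x) = Metric.infDist x K

/-- `u_K(x) = (x - p_K(x)) / dist(x, K)`. -/
def uvec {n : ℕ} (K : Set (En n)) (p : En n → En n) (x : En n) : En n :=
  (Metric.infDist x K)⁻¹ • (x - p x)

/-- The local parallel volume measure `μ_{K,ρ}`. -/
def parMeas {n : ℕ} (K : Set (En n)) (p : En n → En n) (ρ : ℝ) :
    Measure (En n × En n) :=
  Measure.map (fun x => (p x, uvec K p x)) (volume.restrict (shell K ρ))

/-- A test function for the bounded Lipschitz distance on `ℝⁿ × ℝⁿ`: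
Lipschitz constant at most 1 w.r.t. the Euclidean metric on the product, and `sup |f| ≤ 1`. -/
def IsBLFun {n : ℕ} (f : En n × En n → ℝ) : Prop :=
  (∀ a b : En n × En n, |f a - f b| ≤ Real.sqrt (‖a.1 - b.1‖ ^ 2 + ‖a.2 - b.2‖ ^ 2)) ∧
  ∀ a, |f a| ≤ 1

/-- `κ_m`, the volume of the `m`-dimensional unit ball. -/
def kappa (m : ℕ) : ℝ :=
  (volume (Metric.closedBall (0 : EuclideanSpace ℝ (Fin m)) 1)).toReal

/-- The matrix of the linear system from the local Steiner formula at `ρ_j = j/n`. -/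
def steinerMatrix (n : ℕ) : Matrix (Fin n) (Fin n) ℝ :=
  Matrix.of fun j i => ((j.1 + 1 : ℝ) / n) ^ (n - i.1) * kappa (n - i.1)

/-- The coefficients `a_{ij}` expressing the support measures via local parallel volumes. -/
def steinerCoeff (n : ℕ) : Matrix (Fin n) (Fin n) ℝ := (steinerMatrix n)⁻¹

/-- A test function for the bounded Lipschitz distance on the sphere `S^{n-1}`. -/
def IsSphereBLFun {n : ℕ} (g : En n → ℝ) : Prop :=
  (∀ a b : En n, ‖a‖ = 1 → ‖b‖ = 1 → |g a - g b| ≤ ‖a - b‖) ∧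
  ∀ a : En n, ‖a‖ = 1 → |g a| ≤ 1


theorem proj_continuous {n : ℕ} {K : Set (En n)} (hK : IsConvexBody K) {p : En n → En n}
    (hp : IsMetricProj K p) : Continuous p := by
  have key : ∀ x, ∀ w ∈ K, inner ℝ (x - p x) (w - p x) ≤ 0 := by
    intro x
    rw [← norm_eq_iInf_iff_real_inner_le_zero hK.2.2 (hp x).1, ← dist_eq_norm, (hp x).2,
      Metric.infDist_eq_iInf]
    simp only [dist_eq_norm]
  have hl : LipschitzWith 1 p := by
    refine LipschitzWith.of_dist_le_mul fun x y => ?_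
    rw [dist_eq_norm, dist_eq_norm, NNReal.coe_one, one_mul]
    have h1 := key x (p y) (hp y).1
    have h2 := key y (p x) (hp x).1
    have h3 : ‖p x - p y‖ ^ 2 ≤ inner ℝ (x - y) (p x - p y) := by
      rw [← real_inner_self_eq_norm_sq]
      simp only [inner_sub_left, inner_sub_right] at *
      linarith
    have h4 := real_inner_le_norm (x - y) (p x - p y)
    by_contra hc
    push Not at hc
    nlinarith [norm_nonneg (x - y), norm_nonneg (p x - p y)]
  exact hl.continuous

theorem uvec_measurable {n : ℕ} {K : Set (En n)} (hK : IsConvexBody K) {p : En n → En n}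
    (hp : IsMetricProj K p) : Measurable (uvec K p) := by
  have hc := proj_continuous hK hp
  have h1 : Measurable (fun x : En n => (Metric.infDist x K)⁻¹) :=
    (Metric.continuous_infDist_pt K).measurable.inv
  have h2 : Measurable (fun x : En n => x - p x) := (continuous_id.sub hc).measurable
  exact h1.smul h2

theorem uvec_norm_le {n : ℕ} {K : Set (En n)} {p : En n → En n}
    (hp : IsMetricProj K p) (x : En n) : ‖uvec K p x‖ ≤ 1 := by
  unfold uvec
  rw [norm_smul, ← dist_eq_norm, (hp x).2, norm_inv, Real.norm_of_nonneg Metric.infDist_nonneg]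
  exact inv_mul_le_one

theorem pbody_compact {n : ℕ} {K : Set (En n)} (hK : IsConvexBody K) (ρ : ℝ) :
    IsCompact (pbody K ρ) := hK.2.1.add (isCompact_closedBall _ _)

theorem shell_meas {n : ℕ} {K : Set (En n)} (hK : IsConvexBody K) (ρ : ℝ) :
    MeasurableSet (shell K ρ) :=
  (pbody_compact hK ρ).measurableSet.diff hK.2.1.measurableSet

theorem shell_lt {n : ℕ} {K : Set (En n)} (hK : IsConvexBody K) (ρ : ℝ) :
    volume (shell K ρ) < ⊤ :=
  (measure_mono sdiff_subset).trans_lt (pbody_compact hK ρ).measure_lt_top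

theorem BL_continuous {n : ℕ} {f : En n × En n → ℝ} (hf : IsBLFun f) : Continuous f := by
  rw [continuous_iff_continuousAt]
  intro b
  rw [ContinuousAt, tendsto_iff_dist_tendsto_zero]
  refine squeeze_zero (fun _ => dist_nonneg) (fun a => hf.1 a b) ?_
  have : Continuous fun a : En n × En n =>
      Real.sqrt (‖a.1 - b.1‖ ^ 2 + ‖a.2 - b.2‖ ^ 2) := by fun_prop
  simpa using this.tendsto b

theorem bdd_integrableOn {n : ℕ} {A : Set (En n)} (hA : MeasurableSet A) (hv : volume A < ⊤)
    {E : Type*} [NormedAddCommGroup E] {g : En n → E} (hg : AEStronglyMeasurable g (volume.restrict A))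
    (C : ℝ) (hC : ∀ x, ‖g x‖ ≤ C) : IntegrableOn g A volume := by
  haveI : IsFiniteMeasure (volume.restrict A) := ⟨by simpa using hv⟩
  exact Integrable.of_bound hg C (Filter.Eventually.of_forall hC)

/-- **Lemma 4.1**: `d_bL(μ_{K,ρ}, μ_{L,ρ})` is bounded by
`∫_{K^ρ ∩ L^ρ} ‖p_K - p_L‖ + ∫_{K^ρ ∩ L^ρ} ‖u_K - u_L‖ + vol_n(K^ρ △ L^ρ)`. -/
theorem dbL_parMeas_le (n : ℕ) (K L : Set (En n))
    (hK : IsConvexBody K) (hL : IsConvexBody L) (ρ : ℝ) (hρ : 0 < ρ)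
    (pK pL : En n → En n) (hpK : IsMetricProj K pK) (hpL : IsMetricProj L pL)
    (f : En n × En n → ℝ) (hf : IsBLFun f) :
    |(∫ a, f a ∂(parMeas K pK ρ)) - ∫ a, f a ∂(parMeas L pL ρ)| ≤
      (∫ x in shell K ρ ∩ shell L ρ, ‖pK x - pL x‖) +
        (∫ x in shell K ρ ∩ shell L ρ, ‖uvec K pK x - uvec L pL x‖) +
        (volume (symmDiff (shell K ρ) (shell L ρ))).toReal := by
  have hA := shell_meas hK ρ
  have hB := shell_meas hL ρ
  have hAv := shell_lt hK ρ
  have hBv := shell_lt hL ρ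
  have mK : Measurable (fun x => (pK x, uvec K pK x)) :=
    (proj_continuous hK hpK).measurable.prodMk (uvec_measurable hK hpK)
  have mL : Measurable (fun x => (pL x, uvec L pL x)) :=
    (proj_continuous hL hpL).measurable.prodMk (uvec_measurable hL hpL)
  have hfc := BL_continuous hf
  unfold parMeas
  rw [integral_map mK.aemeasurable hfc.aestronglyMeasurable,
    integral_map mL.aemeasurable hfc.aestronglyMeasurable]
  generalize shell K ρ = A at *
  generalize shell L ρ = B at *
  have hABv : volume (A ∩ B) < ⊤ := (measure_mono inter_subset_left).trans_lt hAv
  set gK : En n → ℝ := fun x => f (pK x, uvec K pK x) with hgK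
  set gL : En n → ℝ := fun x => f (pL x, uvec L pL x) with hgL
  have mgK : Measurable gK := hfc.measurable.comp mK
  have mgL : Measurable gL := hfc.measurable.comp mL
  have iK : IntegrableOn gK A volume :=
    bdd_integrableOn hA hAv mgK.aestronglyMeasurable 1 (fun x => hf.2 _)
  have iL : IntegrableOn gL B volume :=
    bdd_integrableOn hB hBv mgL.aestronglyMeasurable 1 (fun x => hf.2 _)
  have sK := integral_inter_add_sdiff hB iK
  have sL := integral_inter_add_sdiff hA iL
  rw [inter_comm B A] at sL
  have bK : ‖∫ x in A \ B, gK x‖ ≤ 1 * volume.real (A \ B) :=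
    norm_setIntegral_le_of_norm_le_const ((measure_mono sdiff_subset).trans_lt hAv)
      (fun x _ => hf.2 _)
  have bL : ‖∫ x in B \ A, gL x‖ ≤ 1 * volume.real (B \ A) :=
    norm_setIntegral_le_of_norm_le_const ((measure_mono sdiff_subset).trans_lt hBv)
      (fun x _ => hf.2 _)
  have hsd : (volume (symmDiff A B)).toReal = volume.real (A \ B) + volume.real (B \ A) := by
    rw [Set.symmDiff_def]
    exact measureReal_union (Set.disjoint_left.2 fun x h1 h2 => h2.2 h1.1) (hB.diff hA)
      ((measure_mono sdiff_subset).trans_lt hAv).ne ((measure_mono sdiff_subset).trans_lt hBv).ne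
  obtain ⟨CK, hCK⟩ := hK.2.1.isBounded.exists_norm_le
  obtain ⟨CL, hCL⟩ := hL.2.1.isBounded.exists_norm_le
  have i1 : IntegrableOn (fun x => ‖pK x - pL x‖) (A ∩ B) volume :=
    bdd_integrableOn (hA.inter hB) hABv
      ((proj_continuous hK hpK).sub (proj_continuous hL hpL)).norm.aestronglyMeasurable (CK + CL)
      (fun x => by
        rw [norm_norm]
        exact (norm_sub_le _ _).trans (add_le_add (hCK _ (hpK x).1) (hCL _ (hpL x).1)))
  have i2 : IntegrableOn (fun x => ‖uvec K pK x - uvec L pL x‖) (A ∩ B) volume :=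
    bdd_integrableOn (hA.inter hB) hABv
      ((uvec_measurable hK hpK).sub (uvec_measurable hL hpL)).norm.aestronglyMeasurable (1 + 1)
      (fun x => by
        rw [norm_norm]
        exact (norm_sub_le _ _).trans (add_le_add (uvec_norm_le hpK x) (uvec_norm_le hpL x)))
  have bI : |(∫ x in A ∩ B, gK x) - ∫ x in A ∩ B, gL x| ≤
      (∫ x in A ∩ B, ‖pK x - pL x‖) + ∫ x in A ∩ B, ‖uvec K pK x - uvec L pL x‖ := by
    rw [← integral_sub (iK.mono_set inter_subset_left) (iL.mono_set inter_subset_right),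
      ← integral_add i1 i2, ← Real.norm_eq_abs]
    refine norm_integral_le_of_norm_le (i1.add i2) (Filter.Eventually.of_forall fun x => ?_)
    refine (hf.1 _ _).trans ?_
    refine Real.sqrt_le_iff.2 ⟨by positivity, ?_⟩
    simp only [Pi.add_apply]
    nlinarith [mul_nonneg (norm_nonneg (pK x - pL x)) (norm_nonneg (uvec K pK x - uvec L pL x))]
  rw [hsd, ← sK, ← sL]
  rw [Real.norm_eq_abs] at bK bL
  rw [abs_le] at *
  constructor <;> linarith [bI.1, bI.2, bK.1, bK.2, bL.1, bL.2]

end
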